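/- (Optimal measurement for real X states, condition (ii).) Let a_z, b_z, c_x, c_y, c_z ∈ ℝ with |c_x| ≥ |c_y|, and let ρ = (1/4)(I₄ + a_z σz⊗I₂ + b_z I₂⊗σz + c_x σx⊗σx + c_y σy⊗σy + c_z σz⊗σz) be positive semidefinite. For a unit vector n = (n_x, n_y, n_z) ∈ ℝ³ with 1 ± b_z n_z > 0, define p±(n) = (1 ± b_z n_z)/2, the conditional states ρ±(n) = Tr_B(ρ(I₂⊗Π±))/p±(n) where Π± = (I₂ ± (n_x σx + n_y σy + n_z σz))/2, and the conditional entropy E(n) = p₊(n) S(ρ₊(n)) + p₋(n) S(ρ₋(n)). If |√((1 + c_z)² − (a_z + b_z)²) − √((a_z − b_z − c_z + 1)(b_z − a_z − c_z + 1))| ≤ |c_x + c_y| + |c_x − c_y|, then E(x̂) ≤ E(n) for every unit vector n (with x̂ = (1,0,0)); that is, the optimal projective measurement for the quantum discord is σx. -/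

import Mathlib

open Matrix Complex
open scoped Kronecker ComplexOrder

noncomputable def σx : Matrix (Fin 2) (Fin 2) ℂ := !![0, 1; 1, 0]
noncomputable def σy : Matrix (Fin 2) (Fin 2) ℂ := !![0, -Complex.I; Complex.I, 0]
noncomputable def σz : Matrix (Fin 2) (Fin 2) ℂ := !![1, 0; 0, -1]

/-- The partial trace over the second tensor factor of a 4×4 matrix on ℂ²⊗ℂ². -/
noncomputable def trB (M : Matrix (Fin 2 × Fin 2) (Fin 2 × Fin 2) ℂ) :
    Matrix (Fin 2) (Fin 2) ℂ :=
  fun i j => ∑ k : Fin 2, M (i, k) (j, k)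

/-- The projector Π_s(n) = (I₂ + s(n_x σx + n_y σy + n_z σz))/2, for s = ±1. -/
noncomputable def projDir (s nx ny nz : ℝ) : Matrix (Fin 2) (Fin 2) ℂ :=
  (1 / 2 : ℂ) • ((1 : Matrix (Fin 2) (Fin 2) ℂ) +
    (s : ℂ) • ((nx : ℂ) • σx + (ny : ℂ) • σy + (nz : ℂ) • σz))

/-- The von Neumann entropy (base-2) of a 2×2 positive semidefinite matrix of trace 1:
its eigenvalues are μ and 1−μ with μ(1−μ) = det σ, so
μ = (1 + √(1 − 4 Re(det σ)))/2, and S = −μ log₂ μ − (1−μ) log₂(1−μ)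
(with the convention 0·log₂ 0 = 0, automatic since `Real.logb 2 0 = 0`). -/
noncomputable def entropy2 (σ : Matrix (Fin 2) (Fin 2) ℂ) : ℝ :=
  let μ : ℝ := (1 + Real.sqrt (1 - 4 * σ.det.re)) / 2;
  -(μ * Real.logb 2 μ) - (1 - μ) * Real.logb 2 (1 - μ)

/-- The conditional entropy E(n) = p₊(n) S(ρ₊(n)) + p₋(n) S(ρ₋(n)) of the first qubit
after the projective measurement along n = (n_x,n_y,n_z) on the second qubit, where
p±(n) = (1 ± b_z n_z)/2 and ρ±(n) = Tr_B(ρ(I₂⊗Π±))/p±(n). -/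
noncomputable def condEntropy (ρ : Matrix (Fin 2 × Fin 2) (Fin 2 × Fin 2) ℂ)
    (b_z nx ny nz : ℝ) : ℝ :=
  ((1 + b_z * nz) / 2) * entropy2 (((((1 + b_z * nz) / 2 : ℝ) : ℂ))⁻¹ •
      trB (ρ * ((1 : Matrix (Fin 2) (Fin 2) ℂ) ⊗ₖ projDir 1 nx ny nz))) +
  ((1 - b_z * nz) / 2) * entropy2 (((((1 - b_z * nz) / 2 : ℝ) : ℂ))⁻¹ •
      trB (ρ * ((1 : Matrix (Fin 2) (Fin 2) ℂ) ⊗ₖ projDir (-1) nx ny nz)))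

/-- Entropy of a qubit as a function of the concurrence `C = 2 √det`. -/
noncomputable def concEnt (C : ℝ) : ℝ := Real.binEntropy ((1 + Real.sqrt (1 - C ^ 2)) / 2)

lemma log_diff_ge {s : ℝ} (h0 : 0 ≤ s) (h1 : s < 1) :
    2 * s ≤ Real.log (1 + s) - Real.log (1 - s) := by
  have h := Real.hasSum_log_sub_log_of_abs_lt_one (x := s) (by rw [abs_of_nonneg h0]; exact h1)
  have := le_hasSum h 0 (fun k _ => by positivity)
  simpa using this

noncomputable def slopeFn (s : ℝ) : ℝ :=
  Real.sqrt (1 - s ^ 2) / s * (Real.log (1 + s) - Real.log (1 - s)) / 2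

lemma slopeFn_deriv {s : ℝ} (h0 : 0 < s) (h1 : s < 1) :
    HasDerivAt slopeFn
      ((((-(2 * s) / (2 * Real.sqrt (1 - s ^ 2))) * s - Real.sqrt (1 - s ^ 2) * 1) / s ^ 2 *
        (Real.log (1 + s) - Real.log (1 - s)) +
        Real.sqrt (1 - s ^ 2) / s * (1 / (1 + s) - (-1) / (1 - s))) / 2) s := by
  have hpos : 0 < 1 - s ^ 2 := by nlinarith
  have e1 : HasDerivAt (fun s : ℝ => 1 - s ^ 2) (-(2 * s)) s := by
    simpa using ((hasDerivAt_id s).pow 2).const_sub 1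
  have e2 := (e1.sqrt hpos.ne').div (hasDerivAt_id s) h0.ne'
  have e3 : HasDerivAt (fun s : ℝ => Real.log (1 + s)) (1 / (1 + s)) s :=
    ((hasDerivAt_id s).const_add 1).log (by simp only [id]; linarith)
  have e4 : HasDerivAt (fun s : ℝ => Real.log (1 - s)) ((-1) / (1 - s)) s :=
    ((hasDerivAt_id s).const_sub 1).log (by simp only [id]; linarith)
  exact (e2.mul (e3.sub e4)).div_const 2

lemma slopeFn_anti : AntitoneOn slopeFn (Set.Ioo 0 1) := by
  apply antitoneOn_of_deriv_nonpos (convex_Ioo 0 1)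
  · intro s hs
    exact (slopeFn_deriv hs.1 hs.2).continuousAt.continuousWithinAt
  · intro s hs
    rw [interior_Ioo] at hs
    exact (slopeFn_deriv hs.1 hs.2).differentiableAt.differentiableWithinAt
  · intro s hs
    rw [interior_Ioo] at hs
    obtain ⟨h0, h1⟩ := hs
    rw [(slopeFn_deriv h0 h1).deriv]
    have hpos : 0 < 1 - s ^ 2 := by nlinarith
    have hL := log_diff_ge h0.le h1
    set L := Real.log (1 + s) - Real.log (1 - s)
    have hr : 0 < Real.sqrt (1 - s ^ 2) := Real.sqrt_pos.mpr hpos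
    have hr2 : Real.sqrt (1 - s ^ 2) ^ 2 = 1 - s ^ 2 := Real.sq_sqrt hpos.le
    set r := Real.sqrt (1 - s ^ 2)
    have e : ((((-(2 * s) / (2 * r)) * s - r * 1) / s ^ 2 * L +
        r / s * (1 / (1 + s) - (-1) / (1 - s))) / 2) = (2 * s - L) / (2 * s ^ 2 * r) := by
      have a1 : (1 + s) ≠ 0 := by linarith
      have a2 : (1 - s) ≠ 0 := by linarith
      have k1 : 1 / (1 + s) - (-1) / (1 - s) = 2 / r ^ 2 := by
        rw [hr2]
        have : (1 - s ^ 2) ≠ 0 := hpos.ne'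
        field_simp
        ring
      have k2 : (-(2 * s) / (2 * r)) * s - r * 1 = - 1 / r := by
        field_simp
        linarith
      rw [k1, k2]
      field_simp
      ring
    rw [e]
    apply div_nonpos_of_nonpos_of_nonneg
    · linarith
    · positivity

lemma concEnt_deriv {C : ℝ} (h0 : 0 < C) (h1 : C < 1) :
    HasDerivAt concEnt (slopeFn (Real.sqrt (1 - C ^ 2))) C := by
  have hpos : 0 < 1 - C ^ 2 := by nlinarith
  have e1 : HasDerivAt (fun s : ℝ => 1 - s ^ 2) (-(2 * C)) C := by
    simpa using ((hasDerivAt_id C).pow 2).const_sub 1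
  have e2 := ((e1.sqrt hpos.ne').const_add 1).div_const 2
  have hr : 0 < Real.sqrt (1 - C ^ 2) := Real.sqrt_pos.mpr hpos
  have hr2 : Real.sqrt (1 - C ^ 2) ^ 2 = 1 - C ^ 2 := Real.sq_sqrt hpos.le
  have hr1 : Real.sqrt (1 - C ^ 2) < 1 := by nlinarith
  have e3 := Real.hasDerivAt_binEntropy (p := (1 + Real.sqrt (1 - C ^ 2)) / 2)
    (by positivity) (by linarith)
  have e4 := e3.comp C e2
  refine e4.congr_deriv ?_
  unfold slopeFn
  rw [hr2]
  set r := Real.sqrt (1 - C ^ 2)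
  have hC : Real.sqrt (1 - (1 - C ^ 2)) = C := by
    rw [show 1 - (1 - C ^ 2) = C ^ 2 by ring]
    exact Real.sqrt_sq h0.le
  rw [hC, show 1 - (1 + r) / 2 = (1 - r) / 2 by ring, Real.log_div (by linarith) (by norm_num),
    Real.log_div (by linarith) (by norm_num)]
  field_simp
  ring

lemma concEnt_continuous : Continuous concEnt := by
  unfold concEnt
  exact Real.binEntropy_continuous.comp (by fun_prop)

lemma concEnt_convex : ConvexOn ℝ (Set.Icc 0 1) concEnt := by
  apply MonotoneOn.convexOn_of_deriv (convex_Icc 0 1) concEnt_continuous.continuousOn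
  · intro C hC
    rw [interior_Icc] at hC
    exact (concEnt_deriv hC.1 hC.2).differentiableAt.differentiableWithinAt
  · rw [interior_Icc]
    intro C hC C' hC' hle
    rw [(concEnt_deriv hC.1 hC.2).deriv, (concEnt_deriv hC'.1 hC'.2).deriv]
    have key : ∀ C ∈ Set.Ioo (0 : ℝ) 1, Real.sqrt (1 - C ^ 2) ∈ Set.Ioo (0 : ℝ) 1 := by
      rintro C ⟨h0, h1⟩
      have hpos : 0 < 1 - C ^ 2 := by nlinarith
      refine ⟨Real.sqrt_pos.mpr hpos, ?_⟩
      rw [Real.sqrt_lt' one_pos]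
      nlinarith
    apply slopeFn_anti (key _ hC') (key _ hC)
    apply Real.sqrt_le_sqrt
    nlinarith [hC.1, hC'.1]

lemma concEnt_mono : MonotoneOn concEnt (Set.Icc 0 1) := by
  intro C hC C' hC' hle
  have key : ∀ C ∈ Set.Icc (0 : ℝ) 1, (1 + Real.sqrt (1 - C ^ 2)) / 2 ∈ Set.Icc (2⁻¹ : ℝ) 1 := by
    rintro C ⟨h0, h1⟩
    have h2 : Real.sqrt (1 - C ^ 2) ≤ 1 := by
      rw [Real.sqrt_le_iff]
      constructor <;> nlinarith
    have h3 := Real.sqrt_nonneg (1 - C ^ 2)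
    constructor <;> linarith
  apply Real.binEntropy_strictAntiOn.antitoneOn (key _ hC') (key _ hC)
  have : Real.sqrt (1 - C' ^ 2) ≤ Real.sqrt (1 - C ^ 2) := by
    apply Real.sqrt_le_sqrt
    nlinarith [hC.1, hC'.1]
  linarith

lemma entropy2_eq (σ : Matrix (Fin 2) (Fin 2) ℂ) (q D : ℝ) (hq : 0 < q) (hD : 0 ≤ D)
    (h : σ.det.re = D / (4 * q ^ 2)) :
    entropy2 σ = concEnt (Real.sqrt D / q) / Real.log 2 := by
  have e : 1 - 4 * σ.det.re = 1 - (Real.sqrt D / q) ^ 2 := by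
    rw [h, div_pow, Real.sq_sqrt hD]
    field_simp
  simp only [entropy2, concEnt, e, Real.logb, Real.binEntropy, Real.log_inv]
  ring

lemma det_formula (a b cx cy c s nx ny nz q : ℝ) (hs : s ^ 2 = 1) (hq : q = 1 + s * b * nz)
    (hq0 : 0 < q)
    (ρ : Matrix (Fin 2 × Fin 2) (Fin 2 × Fin 2) ℂ)
    (hρ : ρ = (1 / 4 : ℂ) • ((1 : Matrix (Fin 2 × Fin 2) (Fin 2 × Fin 2) ℂ) +
      (a : ℂ) • (σz ⊗ₖ (1 : Matrix (Fin 2) (Fin 2) ℂ)) +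
      (b : ℂ) • ((1 : Matrix (Fin 2) (Fin 2) ℂ) ⊗ₖ σz) +
      (cx : ℂ) • (σx ⊗ₖ σx) + (cy : ℂ) • (σy ⊗ₖ σy) + (c : ℂ) • (σz ⊗ₖ σz))) :
    ((((q / 2 : ℝ) : ℂ))⁻¹ •
      trB (ρ * ((1 : Matrix (Fin 2) (Fin 2) ℂ) ⊗ₖ projDir s nx ny nz))).det.re =
    (q ^ 2 - (a + s * c * nz) ^ 2 - cx ^ 2 * nx ^ 2 - cy ^ 2 * ny ^ 2) / (4 * q ^ 2) := by
  have hT : trB (ρ * ((1 : Matrix (Fin 2) (Fin 2) ℂ) ⊗ₖ projDir s nx ny nz)) =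
      (1 / 4 : ℂ) • !![(q : ℂ) + (a + s * c * nz), s * (cx * nx - Complex.I * (cy * ny));
        s * (cx * nx + Complex.I * (cy * ny)), (q : ℂ) - (a + s * c * nz)] := by
    subst hq
    subst hρ
    ext i j
    fin_cases i <;> fin_cases j <;>
      simp [trB, projDir, σx, σy, σz, Matrix.mul_apply, Fintype.sum_prod_type,
        Matrix.one_apply] <;> ring_nf
  rw [hT, Matrix.det_smul, Matrix.det_smul, Matrix.det_fin_two_of]
  have hI : Complex.I ^ 2 = -1 := Complex.I_sq
  have hs' : (s : ℂ) ^ 2 = 1 := by exact_mod_cast hs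
  have hqc : (q : ℂ) ≠ 0 := by exact_mod_cast hq0.ne'
  have : (((q / 2 : ℝ) : ℂ))⁻¹ ^ Fintype.card (Fin 2) * ((1 / 4 : ℂ) ^ Fintype.card (Fin 2) *
      (((q : ℂ) + (a + s * c * nz)) * ((q : ℂ) - (a + s * c * nz)) -
        s * (cx * nx - Complex.I * (cy * ny)) * (s * (cx * nx + Complex.I * (cy * ny))))) =
      (((q ^ 2 - (a + s * c * nz) ^ 2 - cx ^ 2 * nx ^ 2 - cy ^ 2 * ny ^ 2) / (4 * q ^ 2) : ℝ) : ℂ)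
      := by
    push_cast
    simp only [Fintype.card_fin]
    field_simp
    linear_combination (-(cx * nx) ^ 2 - (cy * ny) ^ 2 : ℂ) * hs' * 4 +
      (cy * ny) ^ 2 * s ^ 2 * hI * 4
  rw [this, Complex.ofReal_re]

lemma psd_facts (a b cx cy c : ℝ)
    (ρ : Matrix (Fin 2 × Fin 2) (Fin 2 × Fin 2) ℂ)
    (hρ : ρ = (1 / 4 : ℂ) • ((1 : Matrix (Fin 2 × Fin 2) (Fin 2 × Fin 2) ℂ) +
      (a : ℂ) • (σz ⊗ₖ (1 : Matrix (Fin 2) (Fin 2) ℂ)) +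
      (b : ℂ) • ((1 : Matrix (Fin 2) (Fin 2) ℂ) ⊗ₖ σz) +
      (cx : ℂ) • (σx ⊗ₖ σx) + (cy : ℂ) • (σy ⊗ₖ σy) + (c : ℂ) • (σz ⊗ₖ σz)))
    (h : ρ.PosSemidef) :
    0 ≤ 1 + a + b + c ∧ 0 ≤ 1 + a - b - c ∧ 0 ≤ 1 - a + b - c ∧ 0 ≤ 1 - a - b + c ∧
    (cx - cy) ^ 2 ≤ (1 + a + b + c) * (1 - a - b + c) ∧
    (cx + cy) ^ 2 ≤ (1 + a - b - c) * (1 - a + b - c) := by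
  have d0 := h.diag_nonneg (i := (0, 0))
  have d1 := h.diag_nonneg (i := (0, 1))
  have d2 := h.diag_nonneg (i := (1, 0))
  have d3 := h.diag_nonneg (i := (1, 1))
  have m1 := (h.submatrix ![((0 : Fin 2), (0 : Fin 2)), (1, 1)]).det_nonneg
  have m2 := (h.submatrix ![((0 : Fin 2), (1 : Fin 2)), (1, 0)]).det_nonneg
  rw [Matrix.det_fin_two] at m1 m2
  subst hρ
  simp [σx, σy, σz, Complex.le_def] at d0 d1 d2 d3 m1 m2
  refine ⟨?_, ?_, ?_, ?_, ?_, ?_⟩ <;> nlinarith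

lemma le_of_sq_le_aux {x y : ℝ} (h : x ^ 2 ≤ y ^ 2) (hy : 0 ≤ y) : x ≤ y :=
  le_trans (le_abs_self x) (abs_le_of_sq_le_sq h hy)

lemma sqrt_sum_ge (P Q R z : ℝ) (hP : 0 ≤ P) (hR : 0 ≤ R) (hd : Q ^ 2 ≤ P * R) :
    2 * Real.sqrt P ≤ Real.sqrt (P + 2 * Q * z + R * z ^ 2) +
      Real.sqrt (P - 2 * Q * z + R * z ^ 2) ∧
    0 ≤ P + 2 * Q * z + R * z ^ 2 ∧ 0 ≤ P - 2 * Q * z + R * z ^ 2 := by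
  have hz : (2 * Q * z) ^ 2 ≤ (P + R * z ^ 2) ^ 2 - (P - R * z ^ 2) ^ 2 := by
    nlinarith [mul_le_mul_of_nonneg_right hd (sq_nonneg z)]
  have hs : 0 ≤ P + R * z ^ 2 := by positivity
  have habs : |2 * Q * z| ≤ P + R * z ^ 2 := by
    apply abs_le_of_sq_le_sq _ hs
    nlinarith [sq_nonneg (P - R * z ^ 2)]
  obtain ⟨l1, l2⟩ := abs_le.mp habs
  have h1 : 0 ≤ P + 2 * Q * z + R * z ^ 2 := by linarith
  have h2 : 0 ≤ P - 2 * Q * z + R * z ^ 2 := by linarith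
  refine ⟨?_, h1, h2⟩
  have s1 := Real.sq_sqrt h1
  have s2 := Real.sq_sqrt h2
  have s0 := Real.sq_sqrt hP
  have n1 := Real.sqrt_nonneg (P + 2 * Q * z + R * z ^ 2)
  have n2 := Real.sqrt_nonneg (P - 2 * Q * z + R * z ^ 2)
  set u := Real.sqrt (P + 2 * Q * z + R * z ^ 2)
  set v := Real.sqrt (P - 2 * Q * z + R * z ^ 2)
  have huv : P - R * z ^ 2 ≤ u * v := by
    apply le_of_sq_le_aux _ (mul_nonneg n1 n2)
    rw [mul_pow, s1, s2]
    nlinarith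
  apply le_of_sq_le_aux _ (add_nonneg n1 n2)
  nlinarith


set_option maxHeartbeats 1000000 in
lemma poly_facts (a b cx cy c : ℝ) (hxy : |cy| ≤ |cx|)
    (h1 : 0 ≤ 1 + a + b + c) (h2 : 0 ≤ 1 + a - b - c) (h3 : 0 ≤ 1 - a + b - c)
    (h4 : 0 ≤ 1 - a - b + c)
    (h5 : (cx - cy) ^ 2 ≤ (1 + a + b + c) * (1 - a - b + c))
    (h6 : (cx + cy) ^ 2 ≤ (1 + a - b - c) * (1 - a + b - c))
    (hcond : |Real.sqrt ((1 + c) ^ 2 - (a + b) ^ 2) -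
        Real.sqrt ((a - b - c + 1) * (b - a - c + 1))| ≤ |cx + cy| + |cx - cy|) :
    0 ≤ 1 - a ^ 2 - cx ^ 2 ∧ 0 ≤ b ^ 2 - c ^ 2 + cx ^ 2 ∧
    (b - a * c) ^ 2 ≤ (1 - a ^ 2 - cx ^ 2) * (b ^ 2 - c ^ 2 + cx ^ 2) := by
  have eU : (1 + c) ^ 2 - (a + b) ^ 2 = (1 + a + b + c) * (1 - a - b + c) := by ring
  have eV : (a - b - c + 1) * (b - a - c + 1) = (1 + a - b - c) * (1 - a + b - c) := by ring
  rw [eU, eV] at hcond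
  have hU := Real.sq_sqrt (mul_nonneg h1 h4)
  have hV := Real.sq_sqrt (mul_nonneg h2 h3)
  have nU := Real.sqrt_nonneg ((1 + a + b + c) * (1 - a - b + c))
  have nV := Real.sqrt_nonneg ((1 + a - b - c) * (1 - a + b - c))
  have aU := Real.abs_le_sqrt h5
  have aV := Real.abs_le_sqrt h6
  set U := Real.sqrt ((1 + a + b + c) * (1 - a - b + c))
  set V := Real.sqrt ((1 + a - b - c) * (1 - a + b - c))
  have hS : (|cx + cy| + |cx - cy|) ^ 2 = 4 * cx ^ 2 := by
    have : |cx + cy| * |cx - cy| = cx ^ 2 - cy ^ 2 := by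
      rw [← abs_mul, show (cx + cy) * (cx - cy) = cx ^ 2 - cy ^ 2 by ring, abs_of_nonneg]
      have := sq_le_sq.mpr hxy
      linarith
    nlinarith [sq_abs (cx + cy), sq_abs (cx - cy)]
  have hS0 : 0 ≤ |cx + cy| + |cx - cy| := by positivity
  set S := |cx + cy| + |cx - cy|
  have hlo : (U - V) ^ 2 ≤ 4 * cx ^ 2 := by
    rw [← hS]
    exact sq_le_sq.mpr (by rwa [abs_of_nonneg hS0])
  have hhi : 4 * cx ^ 2 ≤ (U + V) ^ 2 := by
    rw [← hS]
    exact pow_le_pow_left₀ hS0 (by linarith) 2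
  have hd : (b - a * c) ^ 2 ≤ (1 - a ^ 2 - cx ^ 2) * (b ^ 2 - c ^ 2 + cx ^ 2) := by
    have hab : |4 * cx ^ 2 - (U ^ 2 + V ^ 2)| ≤ 2 * (U * V) := by
      rw [abs_le]
      constructor <;> linarith
    have hsq := pow_le_pow_left₀ (abs_nonneg _) hab 2
    rw [sq_abs] at hsq
    have e : (2 * (U * V)) ^ 2 = 4 * (U ^ 2 * V ^ 2) := by ring
    rw [e, hU, hV] at hsq
    linarith
  have hP : 0 ≤ 1 - a ^ 2 - cx ^ 2 := by
    have hUV : 2 * (U * V) ≤ (1 + a + b + c) * (1 - a + b - c) +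
        (1 + a - b - c) * (1 - a - b + c) := by
      apply le_of_sq_le_aux
      · have e : (2 * (U * V)) ^ 2 = 4 * (U ^ 2 * V ^ 2) := by ring
        rw [e, hU, hV]
        nlinarith [sq_nonneg ((1 + a + b + c) * (1 - a + b - c) -
          (1 + a - b - c) * (1 - a - b + c))]
      · have := mul_nonneg h1 h3
        have := mul_nonneg h2 h4
        linarith
    linarith
  refine ⟨hP, ?_, hd⟩
  rcases hP.eq_or_lt with h0 | h0
  · rw [← h0, zero_mul] at hd
    have hb : b - a * c = 0 := by
      have := le_antisymm hd (sq_nonneg _)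
      exact pow_eq_zero_iff (two_ne_zero) |>.mp this
    have hb' : b = a * c := by linarith
    have e : b ^ 2 - c ^ 2 + cx ^ 2 = (1 - a ^ 2) * (1 - c ^ 2) := by
      rw [hb']; linear_combination h0
    rw [e]
    have p1 : 0 ≤ (1 - a) * (1 + a) := mul_nonneg (by linarith) (by linarith)
    have p2 : 0 ≤ (1 - c) * (1 + c) := mul_nonneg (by linarith) (by linarith)
    exact mul_nonneg (by linarith) (by linarith)
  · by_contra hneg
    push Not at hneg
    linarith [sq_nonneg (b - a * c), mul_pos h0 (neg_pos.mpr hneg)]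

/-- Optimal measurement for real X states, condition (ii): if
|√((1 + c_z)² − (a_z + b_z)²) − √((a_z − b_z − c_z + 1)(b_z − a_z − c_z + 1))|
  ≤ |c_x + c_y| + |c_x − c_y|, then the conditional entropy is minimized by the σx
measurement, i.e. E(x̂) ≤ E(n) for every unit vector n. -/
theorem optimal_measurement_condition_ii (a_z b_z c_x c_y c_z : ℝ)
    (hxy : |c_y| ≤ |c_x|)
    (ρ : Matrix (Fin 2 × Fin 2) (Fin 2 × Fin 2) ℂ)
    (hρ : ρ = (1 / 4 : ℂ) • ((1 : Matrix (Fin 2 × Fin 2) (Fin 2 × Fin 2) ℂ) +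
      (a_z : ℂ) • (σz ⊗ₖ (1 : Matrix (Fin 2) (Fin 2) ℂ)) +
      (b_z : ℂ) • ((1 : Matrix (Fin 2) (Fin 2) ℂ) ⊗ₖ σz) +
      (c_x : ℂ) • (σx ⊗ₖ σx) + (c_y : ℂ) • (σy ⊗ₖ σy) + (c_z : ℂ) • (σz ⊗ₖ σz)))
    (hpsd : ρ.PosSemidef)
    (hcond : |Real.sqrt ((1 + c_z) ^ 2 - (a_z + b_z) ^ 2) -
        Real.sqrt ((a_z - b_z - c_z + 1) * (b_z - a_z - c_z + 1))| ≤
      |c_x + c_y| + |c_x - c_y|) :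
    ∀ nx ny nz : ℝ, nx ^ 2 + ny ^ 2 + nz ^ 2 = 1 →
      0 < 1 + b_z * nz → 0 < 1 - b_z * nz →
      condEntropy ρ b_z 1 0 0 ≤ condEntropy ρ b_z nx ny nz := by
  obtain ⟨h1, h2, h3, h4, h5, h6⟩ := psd_facts a_z b_z c_x c_y c_z ρ hρ hpsd
  obtain ⟨hP, hR, hd⟩ := poly_facts a_z b_z c_x c_y c_z hxy h1 h2 h3 h4 h5 h6 hcond
  intro nx ny nz hn hq1 hq2
  obtain ⟨hsum, hD1, hD2⟩ := sqrt_sum_ge _ _ _ nz hP hR hd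
  have hy : c_y ^ 2 * ny ^ 2 ≤ c_x ^ 2 * ny ^ 2 :=
    mul_le_mul_of_nonneg_right (sq_le_sq.mpr hxy) (sq_nonneg _)
  have hx2 : c_x ^ 2 * nx ^ 2 + c_x ^ 2 * ny ^ 2 = c_x ^ 2 - c_x ^ 2 * nz ^ 2 := by
    linear_combination c_x ^ 2 * hn
  -- the two determinants for direction n
  obtain ⟨A, hA⟩ : ∃ A, A = (1 + b_z * nz) ^ 2 - (a_z + 1 * c_z * nz) ^ 2 -
    c_x ^ 2 * nx ^ 2 - c_y ^ 2 * ny ^ 2 := ⟨_, rfl⟩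
  obtain ⟨B, hB⟩ : ∃ B, B = (1 - b_z * nz) ^ 2 - (a_z + (-1) * c_z * nz) ^ 2 -
    c_x ^ 2 * nx ^ 2 - c_y ^ 2 * ny ^ 2 := ⟨_, rfl⟩
  have hA1 : 1 - a_z ^ 2 - c_x ^ 2 + 2 * (b_z - a_z * c_z) * nz +
      (b_z ^ 2 - c_z ^ 2 + c_x ^ 2) * nz ^ 2 ≤ A := by rw [hA]; linarith
  have hB1 : 1 - a_z ^ 2 - c_x ^ 2 - 2 * (b_z - a_z * c_z) * nz +
      (b_z ^ 2 - c_z ^ 2 + c_x ^ 2) * nz ^ 2 ≤ B := by rw [hB]; linarith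
  have hA0 : 0 ≤ A := hD1.trans hA1
  have hB0 : 0 ≤ B := hD2.trans hB1
  have hAq : A ≤ (1 + b_z * nz) ^ 2 := by
    rw [hA]
    linarith [sq_nonneg (a_z + 1 * c_z * nz), sq_nonneg (c_x * nx), sq_nonneg (c_y * ny)]
  have hBq : B ≤ (1 - b_z * nz) ^ 2 := by
    rw [hB]
    linarith [sq_nonneg (a_z + (-1) * c_z * nz), sq_nonneg (c_x * nx), sq_nonneg (c_y * ny)]
  have hsum' : 2 * Real.sqrt (1 - a_z ^ 2 - c_x ^ 2) ≤ Real.sqrt A + Real.sqrt B :=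
    hsum.trans (add_le_add (Real.sqrt_le_sqrt hA1) (Real.sqrt_le_sqrt hB1))
  have dA := det_formula a_z b_z c_x c_y c_z 1 nx ny nz (1 + b_z * nz) (by norm_num) (by ring)
    hq1 ρ hρ
  have dB := det_formula a_z b_z c_x c_y c_z (-1) nx ny nz (1 - b_z * nz) (by norm_num) (by ring)
    hq2 ρ hρ
  have d1 := det_formula a_z b_z c_x c_y c_z 1 1 0 0 (1 + b_z * 0) (by norm_num) (by ring)
    (by norm_num) ρ hρ
  have d2 := det_formula a_z b_z c_x c_y c_z (-1) 1 0 0 (1 - b_z * 0) (by norm_num) (by ring)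
    (by norm_num) ρ hρ
  have c1 : (1 + b_z * 0) ^ 2 - (a_z + 1 * c_z * 0) ^ 2 - c_x ^ 2 * 1 ^ 2 - c_y ^ 2 * 0 ^ 2
    = 1 - a_z ^ 2 - c_x ^ 2 := by ring
  have c2 : (1 - b_z * 0) ^ 2 - (a_z + (-1) * c_z * 0) ^ 2 - c_x ^ 2 * 1 ^ 2 - c_y ^ 2 * 0 ^ 2
    = 1 - a_z ^ 2 - c_x ^ 2 := by ring
  rw [← hA] at dA
  rw [← hB] at dB
  rw [c1] at d1
  rw [c2] at d2
  unfold condEntropy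
  rw [entropy2_eq _ _ _ hq1 hA0 dA, entropy2_eq _ _ _ hq2 hB0 dB,
    entropy2_eq _ _ _ (by norm_num) hP d1, entropy2_eq _ _ _ (by norm_num) hP d2]
  have mA : Real.sqrt A / (1 + b_z * nz) ∈ Set.Icc (0 : ℝ) 1 := by
    refine ⟨by positivity, ?_⟩
    rw [div_le_one hq1]
    exact Real.sqrt_le_iff.mpr ⟨hq1.le, hAq⟩
  have mB : Real.sqrt B / (1 - b_z * nz) ∈ Set.Icc (0 : ℝ) 1 := by
    refine ⟨by positivity, ?_⟩
    rw [div_le_one hq2]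
    exact Real.sqrt_le_iff.mpr ⟨hq2.le, hBq⟩
  have w1 : 0 ≤ (1 + b_z * nz) / 2 := by positivity
  have w2 : 0 ≤ (1 - b_z * nz) / 2 := by positivity
  have w3 : (1 + b_z * nz) / 2 + (1 - b_z * nz) / 2 = 1 := by ring
  have hJ := concEnt_convex.2 mA mB w1 w2 w3
  have mem := concEnt_convex.1 mA mB w1 w2 w3
  simp only [smul_eq_mul] at hJ mem
  have eC : (1 + b_z * nz) / 2 * (Real.sqrt A / (1 + b_z * nz)) +
      (1 - b_z * nz) / 2 * (Real.sqrt B / (1 - b_z * nz)) = (Real.sqrt A + Real.sqrt B) / 2 := by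
    have := hq1.ne'
    have := hq2.ne'
    field_simp
  rw [eC] at hJ mem
  have hle : Real.sqrt (1 - a_z ^ 2 - c_x ^ 2) ≤ (Real.sqrt A + Real.sqrt B) / 2 := by linarith
  have hM := concEnt_mono ⟨Real.sqrt_nonneg _, hle.trans mem.2⟩ mem hle
  have hlog : 0 < Real.log 2 := Real.log_pos (by norm_num)
  simp only [mul_zero, add_zero, sub_zero, div_one]
  calc _ = concEnt (Real.sqrt (1 - a_z ^ 2 - c_x ^ 2)) / Real.log 2 := by ring
    _ ≤ ((1 + b_z * nz) / 2 * concEnt (Real.sqrt A / (1 + b_z * nz)) +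
      (1 - b_z * nz) / 2 * concEnt (Real.sqrt B / (1 - b_z * nz))) / Real.log 2 :=
        div_le_div_of_nonneg_right (hM.trans hJ) hlog.le
    _ = _ := by ring
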